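/- (The 'no parallel' part of the Smarandachely denied parallel axiom in the paper's example) Let A, B, C be three non-collinear points of ℝ², call a line an s-line if it passes through exactly one of A, B, C, and let L be the euclidean line through C parallel to the line AB. Then L is an s-line, and for every point u lying on the line AB there is no s-line through u that is parallel to L: every s-line passing through u intersects L. -/

import Mathlib

/-- The euclidean (affine) line of the plane `ℝ²` through the points `p` and `q`. -/
def lineThrough (p q : ℝ × ℝ) : Set (ℝ × ℝ) :=
  {x | ∃ t : ℝ, x = p + t • (q - p)}

/-- A subset of the plane is a (euclidean) line if it is the line through two
distinct points. -/
def IsLine (ℓ : Set (ℝ × ℝ)) : Prop :=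
  ∃ p q : ℝ × ℝ, p ≠ q ∧ ℓ = lineThrough p q

/-- Given three points `A`, `B`, `C` of the plane, an `s`-line is a euclidean
line that passes through one and only one of `A`, `B`, `C`. -/
def IsSLine (A B C : ℝ × ℝ) (ℓ : Set (ℝ × ℝ)) : Prop :=
  IsLine ℓ ∧
    ((A ∈ ℓ ∧ B ∉ ℓ ∧ C ∉ ℓ) ∨ (B ∈ ℓ ∧ A ∉ ℓ ∧ C ∉ ℓ) ∨ (C ∈ ℓ ∧ A ∉ ℓ ∧ B ∉ ℓ))

/-- Two vectors of the plane with zero determinant, the first nonzero, are proportional. -/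
theorem exists_smul_of_det_eq_zero (d v : ℝ × ℝ) (hd : d ≠ 0)
    (hD : d.1 * v.2 - d.2 * v.1 = 0) : ∃ k : ℝ, v = k • d := by
  have hn : d.1 * d.1 + d.2 * d.2 ≠ 0 := by
    intro h
    apply hd
    ext
    · simp only [Prod.fst_zero]; nlinarith [mul_self_nonneg d.1, mul_self_nonneg d.2]
    · simp only [Prod.snd_zero]; nlinarith [mul_self_nonneg d.1, mul_self_nonneg d.2]
  refine ⟨(v.1 * d.1 + v.2 * d.2) / (d.1 * d.1 + d.2 * d.2), ?_⟩
  ext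
  · simp only [Prod.smul_fst, smul_eq_mul]
    rw [div_mul_eq_mul_div, eq_div_iff hn]
    linear_combination (-d.2) * hD
  · simp only [Prod.smul_snd, smul_eq_mul]
    rw [div_mul_eq_mul_div, eq_div_iff hn]
    linear_combination d.1 * hD

/-- **The `no parallel' part of the Smarandachely denied parallel axiom** in the
paper's example.  Let `A`, `B`, `C` be non-collinear points of `ℝ²` and let
`L = {C + t • (B - A) : t ∈ ℝ}` be the euclidean line through `C` parallel to
the line `AB`.  Then `L` is an `s`-line, and for every point `u` on the line
`AB` there is no `s`-line through `u` parallel to `L`: every `s`-line through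
`u` meets `L`. -/
theorem smarandachely_no_parallel
    (A B C : ℝ × ℝ) (hAB : A ≠ B) (hC : C ∉ lineThrough A B) :
    IsSLine A B C {x | ∃ t : ℝ, x = C + t • (B - A)} ∧
      ∀ u ∈ lineThrough A B, ∀ ℓ : Set (ℝ × ℝ), IsSLine A B C ℓ → u ∈ ℓ →
        (ℓ ∩ {x | ∃ t : ℝ, x = C + t • (B - A)}).Nonempty := by
  have hv : B - A ≠ 0 := sub_ne_zero.mpr hAB.symm
  constructor
  · refine ⟨⟨C, C + (B - A), ?_, ?_⟩, Or.inr (Or.inr ⟨⟨0, by simp⟩, ?_, ?_⟩)⟩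
    · intro h
      exact hv (by simpa using h)
    · simp [lineThrough]
    · rintro ⟨t, ht⟩
      refine hC ⟨-t, ?_⟩
      rw [neg_smul, ← sub_eq_add_neg, eq_sub_iff_add_eq]
      exact ht.symm
    · rintro ⟨t, ht⟩
      refine hC ⟨1 - t, ?_⟩
      have : C = B - t • (B - A) := by rw [eq_sub_iff_add_eq]; exact ht.symm
      rw [this]
      module
  · rintro u ⟨a, hu⟩ ℓ ⟨⟨p, q, hpq, rfl⟩, hs⟩ ⟨s, hus⟩
    have hd : q - p ≠ 0 := sub_ne_zero.mpr hpq.symm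
    by_cases hD : (q - p).1 * (B - A).2 - (q - p).2 * (B - A).1 = 0
    · exfalso
      obtain ⟨k, hk⟩ := exists_smul_of_det_eq_zero _ _ hd hD
      have hA : A ∈ lineThrough p q := by
        refine ⟨s - a * k, ?_⟩
        have : A = u - a • (B - A) := by rw [hu]; module
        rw [this, hus, hk]
        module
      have hB : B ∈ lineThrough p q := by
        refine ⟨s - a * k + k, ?_⟩
        have : B = u - a • (B - A) + (B - A) := by rw [hu]; module
        rw [this, hus, hk]
        module
      tauto
    · refine ⟨p + (((C - p).1 * (B - A).2 - (C - p).2 * (B - A).1) /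
        ((q - p).1 * (B - A).2 - (q - p).2 * (B - A).1)) • (q - p), ⟨_, rfl⟩,
        ((C - p).1 * (q - p).2 - (C - p).2 * (q - p).1) /
        ((q - p).1 * (B - A).2 - (q - p).2 * (B - A).1), ?_⟩
      simp only [Prod.fst_sub, Prod.snd_sub] at hD ⊢
      have hi := mul_inv_cancel₀ hD
      ext
      · simp only [Prod.fst_add, Prod.smul_fst, Prod.fst_sub, smul_eq_mul]
        linear_combination (C.1 - p.1) * hi
      · simp only [Prod.snd_add, Prod.smul_snd, Prod.snd_sub, smul_eq_mul]
        linear_combination (C.2 - p.2) * hi
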